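/- arXiv:1802.04745 — 8 statements merged into one kernel-verified Lean document; each statement's English description precedes it below -/
import Mathlib

section
/- The map T is strictly order-preserving on K: if x, y ∈ K with y − x ∈ K and x ≠ y, then T(y) − T(x) ∈ K and T(x) ≠ T(y). -/
/-- The positive quadrant in `ℝ²` (with the Euclidean norm). -/
def K : Set (EuclideanSpace ℝ (Fin 2)) := {x | 0 ≤ x 0 ∧ 0 ≤ x 1}

/-- `K₁ = {x ∈ K : x₁ > 2 x₂}`. -/
def K1 : Set (EuclideanSpace ℝ (Fin 2)) := {x | x ∈ K ∧ 2 * x 1 < x 0}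

/-- `K₃ = {x ∈ K : x₂ > 2 x₁}`. -/
def K3 : Set (EuclideanSpace ℝ (Fin 2)) := {x | x ∈ K ∧ 2 * x 0 < x 1}

/-- `K₂ = K \ (K₁ ∪ K₃)`. -/
def K2 : Set (EuclideanSpace ℝ (Fin 2)) := K \ (K1 ∪ K3)

theorem T_coord (T : EuclideanSpace ℝ (Fin 2) → EuclideanSpace ℝ (Fin 2))
    (hT1 : ∀ x ∈ K1, T x = ![2 * (x 0 + x 1), x 0 + x 1])
    (hT2 : ∀ x ∈ K2, T x = (3 : ℝ) • x)
    (hT3 : ∀ x ∈ K3, T x = ![x 0 + x 1, 2 * (x 0 + x 1)])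
    (x : EuclideanSpace ℝ (Fin 2)) (hx : x ∈ K) :
    (2 * x 1 < x 0 ∧ T x 0 = 2 * (x 0 + x 1) ∧ T x 1 = x 0 + x 1) ∨
    (x 0 ≤ 2 * x 1 ∧ x 1 ≤ 2 * x 0 ∧ T x 0 = 3 * x 0 ∧ T x 1 = 3 * x 1) ∨
    (2 * x 0 < x 1 ∧ T x 0 = x 0 + x 1 ∧ T x 1 = 2 * (x 0 + x 1)) := by
  by_cases h1 : 2 * x 1 < x 0
  · left
    have h := hT1 x ⟨hx, h1⟩
    exact ⟨h1, by simpa using congrFun h 0, by simpa using congrFun h 1⟩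
  · by_cases h3 : 2 * x 0 < x 1
    · right; right
      have h := hT3 x ⟨hx, h3⟩
      exact ⟨h3, by simpa using congrFun h 0, by simpa using congrFun h 1⟩
    · right; left
      have h := hT2 x ⟨hx, by rintro (h | h); exacts [h1 h.2, h3 h.2]⟩
      exact ⟨not_lt.mp h1, not_lt.mp h3, by simp [h], by simp [h]⟩

/-- The map `T` of Example 1 is strictly order-preserving on `K`:
if `x, y ∈ K`, `y - x ∈ K` and `x ≠ y`, then `T y - T x ∈ K` and `T x ≠ T y`. -/
theorem stmt_3 (T : EuclideanSpace ℝ (Fin 2) → EuclideanSpace ℝ (Fin 2))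
    (hT1 : ∀ x ∈ K1, T x = ![2 * (x 0 + x 1), x 0 + x 1])
    (hT2 : ∀ x ∈ K2, T x = (3 : ℝ) • x)
    (hT3 : ∀ x ∈ K3, T x = ![x 0 + x 1, 2 * (x 0 + x 1)]) :
    ∀ x ∈ K, ∀ y ∈ K, y - x ∈ K → x ≠ y → T y - T x ∈ K ∧ T x ≠ T y := by
  intro x hx y hy hxy hne
  have cx := T_coord T hT1 hT2 hT3 x hx
  have cy := T_coord T hT1 hT2 hT3 y hy
  obtain ⟨a0, a1⟩ := hx
  obtain ⟨b0, b1⟩ := hy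
  obtain ⟨d0, d1⟩ := hxy
  simp only [PiLp.sub_apply] at d0 d1
  have hs : x 0 + x 1 < y 0 + y 1 := by
    by_contra hc
    apply hne
    ext i
    fin_cases i
    · show x 0 = y 0
      linarith
    · show x 1 = y 1
      linarith
  refine ⟨⟨?_, ?_⟩, fun he => ?_⟩
  · simp only [PiLp.sub_apply]
    rcases cx with ⟨_, _, _⟩ | ⟨_, _, _, _⟩ | ⟨_, _, _⟩ <;>
    rcases cy with ⟨_, _, _⟩ | ⟨_, _, _, _⟩ | ⟨_, _, _⟩ <;> linarith
  · simp only [PiLp.sub_apply]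
    rcases cx with ⟨_, _, _⟩ | ⟨_, _, _, _⟩ | ⟨_, _, _⟩ <;>
    rcases cy with ⟨_, _, _⟩ | ⟨_, _, _, _⟩ | ⟨_, _, _⟩ <;> linarith
  · rw [he] at cx
    rcases cx with ⟨_, _, _⟩ | ⟨_, _, _, _⟩ | ⟨_, _, _⟩ <;>
    rcases cy with ⟨_, _, _⟩ | ⟨_, _, _, _⟩ | ⟨_, _, _⟩ <;> linarith
end

section
/- Suppose T : X → X is order-preserving, 1-homogeneous, and completely continuous, and suppose there exist v, w ∈ K with u := v − w ≠ 0 and −u ∉ K, a constant M > 0, and a positive integer p such that M·T^p(u) − u ∈ K (here T^p is the p-fold iterate of T). Then for every ε > 0, setting S(x) := (M+ε)^{1/p}·T(x), the orbit {S^n(v) : n = 1, 2, …} is unbounded in norm. -/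
open Bornology

/-- If `T` is order-preserving, 1-homogeneous and completely continuous on a Banach
space ordered by a closed cone `K`, and `M T^p(u) ≽ u` for some `u = v - w` with
`v, w ∈ K`, `u ≠ 0`, `-u ∉ K`, then for every `ε > 0` the orbit of `v` under
`S = (M+ε)^{1/p} T` is unbounded in norm. -/
theorem stmt_6 {X : Type*} [NormedAddCommGroup X] [NormedSpace ℝ X] [CompleteSpace X]
    (K : Set X) (hKne : K.Nonempty) (hKcl : IsClosed K)
    (hKsmul : ∀ t : ℝ, 0 ≤ t → ∀ x ∈ K, t • x ∈ K)
    (hKadd : ∀ x ∈ K, ∀ y ∈ K, x + y ∈ K)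
    (hKpointed : ∀ x ∈ K, -x ∈ K → x = 0)
    (T : X → X)
    (hTmono : ∀ x y : X, y - x ∈ K → T y - T x ∈ K)
    (hThom : ∀ t : ℝ, 0 ≤ t → ∀ x : X, T (t • x) = t • T x)
    (hTcont : Continuous T)
    (hTcompact : ∀ s : Set X, IsBounded s → IsCompact (closure (T '' s)))
    (v w : X) (hv : v ∈ K) (hw : w ∈ K) (u : X) (hu : u = v - w)
    (hu0 : u ≠ 0) (hnu : -u ∉ K)
    (M : ℝ) (hM : 0 < M) (p : ℕ) (hp : 0 < p)
    (hMu : M • (T^[p] u) - u ∈ K) :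
    ∀ ε : ℝ, 0 < ε →
      ¬ IsBounded {x : X | ∃ n : ℕ, 1 ≤ n ∧
        x = (fun y => ((M + ε) ^ ((1 : ℝ) / p)) • T y)^[n] v} := by
  intro ε hε hbdd
  have hMε : 0 < M + ε := by linarith
  set c : ℝ := (M + ε) ^ ((1 : ℝ) / p) with hc
  have hc0 : 0 ≤ c := (Real.rpow_pos_of_pos hMε _).le
  have hcp : c ^ p = M + ε := by
    rw [hc, ← Real.rpow_natCast, ← Real.rpow_mul hMε.le, one_div,
      inv_mul_cancel₀ (by exact_mod_cast hp.ne'), Real.rpow_one]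
  set S : X → X := fun y => c • T y with hS
  have hSmono : ∀ x y : X, y - x ∈ K → S y - S x ∈ K := by
    intro x y h
    have := hKsmul c hc0 _ (hTmono x y h)
    rwa [smul_sub] at this
  have hSnmono : ∀ n : ℕ, ∀ x y : X, y - x ∈ K → S^[n] y - S^[n] x ∈ K := by
    intro n
    induction n with
    | zero => intro x y h; simpa using h
    | succ n ih =>
      intro x y h
      rw [Function.iterate_succ_apply, Function.iterate_succ_apply]
      exact ih _ _ (hSmono x y h)
  have hSnhom : ∀ n : ℕ, ∀ t : ℝ, 0 ≤ t → ∀ x : X, S^[n] (t • x) = t • S^[n] x := by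
    intro n t ht x
    induction n with
    | zero => rfl
    | succ n ih =>
      rw [Function.iterate_succ_apply', Function.iterate_succ_apply', ih]
      simp only [hS]
      rw [hThom t ht, smul_comm]
  have hST : ∀ n : ℕ, ∀ x : X, S^[n] x = c ^ n • T^[n] x := by
    intro n x
    induction n with
    | zero => simp
    | succ n ih =>
      rw [Function.iterate_succ_apply', Function.iterate_succ_apply', ih]
      simp only [hS]
      rw [hThom _ (pow_nonneg hc0 n), smul_smul, pow_succ']
  set l : ℝ := (M + ε) / M with hl
  have hl1 : 1 < l := by rw [hl, one_lt_div hM]; linarith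
  have hl0 : 0 < l := by linarith
  have hstep : S^[p] u - l • u ∈ K := by
    have := hKsmul l hl0.le _ hMu
    rwa [smul_sub, smul_smul, hl, div_mul_cancel₀ _ hM.ne', ← hcp, ← hST, hcp] at this
  have hiter : ∀ n : ℕ, S^[p * n] u - l ^ n • u ∈ K := by
    intro n
    induction n with
    | zero =>
      obtain ⟨k, hk⟩ := hKne
      have := hKsmul 0 le_rfl k hk
      simpa using this
    | succ n ih =>
      have h1 := hSnmono p _ _ ih
      rw [hSnhom p _ (pow_nonneg hl0.le n), ← Function.iterate_add_apply] at h1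
      have h2 := hKadd _ h1 _ (hKsmul (l ^ n) (pow_nonneg hl0.le n) _ hstep)
      rw [smul_sub, sub_add_sub_cancel, smul_smul, ← pow_succ] at h2
      rwa [Nat.mul_succ, Nat.add_comm]
  have hv' : ∀ n : ℕ, S^[p * n] v - l ^ n • u ∈ K := by
    intro n
    have h1 := hSnmono (p * n) u v (by rw [hu, sub_sub_cancel]; exact hw)
    have h2 := hKadd _ h1 _ (hiter n)
    rwa [sub_add_sub_cancel] at h2
  obtain ⟨C, hC⟩ := hbdd.exists_norm_le
  have hpos : ∀ n : ℕ, 0 < l ^ n := fun n => pow_pos hl0 n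
  have hK : ∀ n : ℕ, (l ^ n)⁻¹ • S^[p * n] v - u ∈ K := by
    intro n
    have h := hKsmul (l ^ n)⁻¹ (inv_nonneg.2 (hpos n).le) _ (hv' n)
    rwa [smul_sub, smul_smul, inv_mul_cancel₀ (hpos n).ne', one_smul] at h
  have hlim0 : Filter.Tendsto (fun n : ℕ => (l ^ n)⁻¹ * C) Filter.atTop (nhds 0) := by
    have h := (tendsto_inv_atTop_zero.comp (tendsto_pow_atTop_atTop_of_one_lt hl1)).mul_const C
    rw [zero_mul] at h
    exact h
  have hlim : Filter.Tendsto (fun n : ℕ => (l ^ n)⁻¹ • S^[p * n] v) Filter.atTop (nhds 0) := by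
    refine squeeze_zero_norm' ?_ hlim0
    filter_upwards [Filter.eventually_ge_atTop 1] with n hn
    rw [norm_smul, Real.norm_of_nonneg (inv_nonneg.2 (hpos n).le)]
    exact mul_le_mul_of_nonneg_left (hC _ ⟨p * n, Nat.mul_pos hp hn, rfl⟩)
      (inv_nonneg.2 (hpos n).le)
  have hfin := hKcl.mem_of_tendsto (hlim.sub_const u) (Filter.Eventually.of_forall hK)
  rw [zero_sub] at hfin
  exact hnu hfin
end

section
/- Suppose T : X → X is order-preserving and 1-homogeneous, and suppose there exist v, w ∈ K with u := v − w, a constant M > 0, and a positive integer p such that M·T^p(u) − u ∈ K. Then for every ε > 0, setting S(x) := (M+ε)^{1/p}·T(x), for every positive integer k one has S^{kp}(u) ≼ S^{kp}(v) and (1 + ε/M)^k·u ≼ S^{kp}(u); in particular (1 + ε/M)^k·u ≼ S^{kp}(v). -/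
/-- If `T` is order-preserving and 1-homogeneous on a Banach space ordered by a
closed cone `K`, `u = v - w` with `v, w ∈ K`, and `M T^p(u) ≽ u`, then for every
`ε > 0`, setting `S = (M+ε)^{1/p} T`, one has, for every `k ≥ 1`,
`S^{kp}(u) ≼ S^{kp}(v)` and `(1 + ε/M)^k u ≼ S^{kp}(u)`; in particular
`(1 + ε/M)^k u ≼ S^{kp}(v)`. -/
theorem stmt_7 {X : Type*} [NormedAddCommGroup X] [NormedSpace ℝ X] [CompleteSpace X]
    (K : Set X) (hKne : K.Nonempty) (hKcl : IsClosed K)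
    (hKsmul : ∀ t : ℝ, 0 ≤ t → ∀ x ∈ K, t • x ∈ K)
    (hKadd : ∀ x ∈ K, ∀ y ∈ K, x + y ∈ K)
    (hKpointed : ∀ x ∈ K, -x ∈ K → x = 0)
    (T : X → X)
    (hTmono : ∀ x y : X, y - x ∈ K → T y - T x ∈ K)
    (hThom : ∀ t : ℝ, 0 ≤ t → ∀ x : X, T (t • x) = t • T x)
    (v w : X) (hv : v ∈ K) (hw : w ∈ K) (u : X) (hu : u = v - w)
    (M : ℝ) (hM : 0 < M) (p : ℕ) (hp : 0 < p)
    (hMu : M • (T^[p] u) - u ∈ K) :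
    ∀ ε : ℝ, 0 < ε → ∀ k : ℕ, 1 ≤ k →
      (fun y => ((M + ε) ^ ((1 : ℝ) / p)) • T y)^[k * p] v
          - (fun y => ((M + ε) ^ ((1 : ℝ) / p)) • T y)^[k * p] u ∈ K ∧
      (fun y => ((M + ε) ^ ((1 : ℝ) / p)) • T y)^[k * p] u
          - ((1 + ε / M) ^ k) • u ∈ K ∧
      (fun y => ((M + ε) ^ ((1 : ℝ) / p)) • T y)^[k * p] v
          - ((1 + ε / M) ^ k) • u ∈ K := by
  intro ε hε k _
  have hMe : 0 < M + ε := by linarith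
  set c : ℝ := (M + ε) ^ ((1 : ℝ) / p) with hc
  have hc0 : 0 ≤ c := Real.rpow_nonneg hMe.le _
  have hcp : c ^ p = M + ε := by
    rw [hc, one_div]
    exact Real.rpow_inv_natCast_pow hMe.le hp.ne'
  set S : X → X := fun y => c • T y with hS
  have hSmono : ∀ n : ℕ, ∀ x y : X, y - x ∈ K → S^[n] y - S^[n] x ∈ K := by
    intro n
    induction n with
    | zero => intro x y h; simpa using h
    | succ n ih =>
      intro x y h
      rw [Function.iterate_succ_apply, Function.iterate_succ_apply]
      apply ih
      simp only [hS]
      rw [← smul_sub]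
      exact hKsmul c hc0 _ (hTmono x y h)
  have hShom : ∀ n : ℕ, ∀ t : ℝ, 0 ≤ t → ∀ x : X, S^[n] (t • x) = t • S^[n] x := by
    intro n
    induction n with
    | zero => intro t _ x; simp
    | succ n ih =>
      intro t ht x
      rw [Function.iterate_succ_apply, Function.iterate_succ_apply, ← ih t ht]
      congr 1
      simp only [hS]
      rw [hThom t ht, smul_comm]
  have hST : ∀ n : ℕ, ∀ x : X, S^[n] x = c ^ n • T^[n] x := by
    intro n x
    induction n with
    | zero => simp
    | succ n ih =>
      rw [Function.iterate_succ_apply', Function.iterate_succ_apply', ih]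
      simp only [hS]
      rw [hThom _ (pow_nonneg hc0 n), smul_smul, pow_succ']
  have hr : 0 ≤ 1 + ε / M := by positivity
  have hbase : S^[p] u - (1 + ε / M) • u ∈ K := by
    have h := hKsmul _ hr _ hMu
    rw [smul_sub, smul_smul] at h
    rw [hST, hcp]
    have e : (1 + ε / M) * M = M + ε := by field_simp
    rwa [e] at h
  have h1 : S^[k * p] v - S^[k * p] u ∈ K := by
    apply hSmono
    rw [hu]
    simpa using hw
  have h2 : ∀ m : ℕ, S^[m * p] u - ((1 + ε / M) ^ m) • u ∈ K := by
    intro m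
    induction m with
    | zero =>
      obtain ⟨x, hx⟩ := hKne
      simpa using hKsmul 0 le_rfl x hx
    | succ m ih =>
      have a := hSmono (m * p) _ _ hbase
      rw [hShom _ _ hr, ← Function.iterate_add_apply] at a
      have b := hKadd _ a _ (hKsmul _ hr _ ih)
      rw [smul_sub, smul_smul, sub_add_sub_cancel, ← pow_succ'] at b
      rwa [Nat.succ_mul]
  refine ⟨h1, h2 k, ?_⟩
  have := hKadd _ h1 _ (h2 k)
  rwa [sub_add_sub_cancel] at this
end

section
/- Suppose T : X → X is order-preserving, 1-homogeneous, and completely continuous, and suppose there exist v, w ∈ K with u := v − w ≠ 0 and −u ∉ K, a constant M > 0, and a positive integer p such that M·T^p(u) − u ∈ K. Then there exist x₀ ∈ K with ‖x₀‖ = 1 and a real λ₀ ≥ M^{−1/p} such that T(x₀) = λ₀·x₀. -/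
open Bornology

section aux
open Filter Topology

variable {X : Type*} [NormedAddCommGroup X] [NormedSpace ℝ X]

/-- Order-increasing sequences in a compact set converge. -/
theorem aux_mono_conv (K : Set X) (hKcl : IsClosed K)
    (hK0 : (0 : X) ∈ K)
    (hKadd : ∀ x ∈ K, ∀ y ∈ K, x + y ∈ K)
    (hKpointed : ∀ x ∈ K, -x ∈ K → x = 0)
    (S : Set X) (hS : IsCompact S) (a : ℕ → X) (ha : ∀ n, a n ∈ S)
    (hmono : ∀ n, a (n + 1) - a n ∈ K) : ∃ l, Tendsto a atTop (𝓝 l) := by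
  have hle : ∀ m k, a (m + k) - a m ∈ K := by
    intro m k
    induction k with
    | zero => simpa using hK0
    | succ k ih =>
      have := hKadd _ (hmono (m + k)) _ ih
      simpa [add_assoc] using this
  have hub : ∀ (φ : ℕ → ℕ) (b : X), StrictMono φ → Tendsto (a ∘ φ) atTop (𝓝 b) →
      ∀ m, b - a m ∈ K := by
    intro φ b hφ hb m
    refine hKcl.mem_of_tendsto (hb.sub_const (a m)) ?_
    filter_upwards [eventually_ge_atTop m] with k hk
    have h1 : m ≤ φ k := hk.trans (hφ.id_le k)
    obtain ⟨j, hj⟩ := Nat.exists_eq_add_of_le h1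
    simp only [Function.comp, hj]
    exact hle m j
  obtain ⟨l, -, φ, hφ, hl⟩ := hS.tendsto_subseq ha
  refine ⟨l, tendsto_of_subseq_tendsto ?_⟩
  intro ns hns
  obtain ⟨ψ, hψ, hψ2⟩ := strictMono_subseq_of_tendsto_atTop hns
  obtain ⟨b, -, χ, hχ, hb⟩ := hS.tendsto_subseq (fun n => ha (ns (ψ n)))
  refine ⟨fun n => ψ (χ n), ?_⟩
  have hb' : Tendsto (a ∘ (fun n => ns (ψ (χ n)))) atTop (𝓝 b) := hb
  have hsm : StrictMono (fun n => ns (ψ (χ n))) := hψ2.comp hχ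
  have h1 : l - b ∈ K := hKcl.mem_of_tendsto (hb'.const_sub l)
    (Eventually.of_forall fun n => hub φ l hφ hl _)
  have h2 : b - l ∈ K := hKcl.mem_of_tendsto (hl.const_sub b)
    (Eventually.of_forall fun n => hub _ b hsm hb' _)
  have h3 : l - b = 0 := hKpointed _ h1 (by simpa using h2)
  rw [sub_eq_zero.1 h3]
  exact hb'

/-- A priori bound in absence of eigenvectors. -/
theorem aux_apriori (K : Set X) (hKcl : IsClosed K)
    (hKsmul : ∀ t : ℝ, 0 ≤ t → ∀ x ∈ K, t • x ∈ K)
    (T : X → X)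
    (hThom : ∀ t : ℝ, 0 ≤ t → ∀ x : X, T (t • x) = t • T x)
    (hTcont : Continuous T)
    (hTcompact : ∀ s : Set X, IsBounded s → IsCompact (closure (T '' s)))
    (B : ℝ) (hno : ∀ μ : ℝ, 0 ≤ μ → μ ≤ B → ∀ x ∈ K, ‖x‖ = 1 → x ≠ μ • T x) :
    ∃ C : ℝ, 0 < C ∧ ∀ μ : ℝ, 0 ≤ μ → μ ≤ B → ∀ x ∈ K, ∀ e : X,
      x = μ • T x + e → ‖x‖ ≤ C * ‖e‖ := by
  by_contra! hcon
  have h : ∀ n : ℕ, ∃ μ : ℝ, 0 ≤ μ ∧ μ ≤ B ∧ ∃ z ∈ K, ‖z‖ = 1 ∧ ∃ f : X,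
      z = μ • T z + f ∧ ‖f‖ ≤ 1 / ((n : ℝ) + 1) := by
    intro n
    have hn : (0 : ℝ) < (n : ℝ) + 1 := by positivity
    obtain ⟨μ, h0, hB, x, hx, e, he, hlt⟩ := hcon ((n : ℝ) + 1) hn
    have hxpos : 0 < ‖x‖ := lt_of_le_of_lt (by positivity) hlt
    refine ⟨μ, h0, hB, ‖x‖⁻¹ • x, hKsmul _ (by positivity) _ hx, ?_, ‖x‖⁻¹ • e, ?_, ?_⟩
    · rw [norm_smul, norm_inv, norm_norm, inv_mul_cancel₀ hxpos.ne']
    · rw [hThom _ (by positivity), smul_comm μ, ← smul_add, ← he]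
    · rw [norm_smul, norm_inv, norm_norm, inv_mul_le_iff₀ hxpos, mul_one_div, le_div_iff₀ hn]
      linarith
  choose μ h0 hB z hz hz1 f hf hfn using h
  have hc := (isCompact_Icc (a := (0 : ℝ)) (b := B)).prod
    (hTcompact (Metric.closedBall 0 1) Metric.isBounded_closedBall)
  obtain ⟨⟨m, y⟩, hmem, φ, hφ, hlim⟩ := hc.tendsto_subseq (x := fun n => (μ n, T (z n)))
    (fun n => ⟨⟨h0 n, hB n⟩, subset_closure ⟨z n, by simp [hz1 n], rfl⟩⟩)
  have hm : Tendsto (fun n => μ (φ n)) atTop (𝓝 m) :=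
    (continuous_fst.tendsto _).comp hlim
  have hy : Tendsto (fun n => T (z (φ n))) atTop (𝓝 y) :=
    (continuous_snd.tendsto _).comp hlim
  have hf0 : Tendsto f atTop (𝓝 0) :=
    squeeze_zero_norm hfn tendsto_one_div_add_atTop_nhds_zero_nat
  have hzl : Tendsto (fun n => z (φ n)) atTop (𝓝 (m • y)) := by
    have := (hm.smul hy).add (hf0.comp hφ.tendsto_atTop)
    rw [add_zero] at this
    refine this.congr fun n => ?_
    exact (hf (φ n)).symm
  have hTz := (hTcont.tendsto _).comp hzl
  have hyT : y = T (m • y) := tendsto_nhds_unique hy hTz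
  refine hno m hmem.1.1 hmem.1.2 (m • y)
    (hKcl.mem_of_tendsto hzl (Eventually.of_forall fun n => hz _)) ?_ (by rw [← hyT])
  exact tendsto_nhds_unique hzl.norm (by simp [hz1])

/-- The monotone resolvent exists at parameter `μ`. -/
def AuxRes (K : Set X) (T : X → X) (μ : ℝ) : Prop :=
  ∃ R : X → X, (∀ e ∈ K, R e ∈ K ∧ R e = μ • T (R e) + e) ∧
    ∀ e ∈ K, ∀ e' ∈ K, e' - e ∈ K → R e' - R e ∈ K

theorem aux_step (K : Set X) (hKcl : IsClosed K)
    (hK0 : (0 : X) ∈ K)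
    (hKsmul : ∀ t : ℝ, 0 ≤ t → ∀ x ∈ K, t • x ∈ K)
    (hKadd : ∀ x ∈ K, ∀ y ∈ K, x + y ∈ K)
    (hKpointed : ∀ x ∈ K, -x ∈ K → x = 0)
    (T : X → X) (hTK : ∀ x ∈ K, T x ∈ K)
    (hTmono : ∀ x y : X, y - x ∈ K → T y - T x ∈ K)
    (hTcont : Continuous T)
    (hTcompact : ∀ s : Set X, IsBounded s → IsCompact (closure (T '' s)))
    (L : ℝ) (hTL : ∀ x, ‖T x‖ ≤ L * ‖x‖)
    (C : ℝ) (hC : 0 < C) (μ : ℝ)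
    (hap : ∀ x ∈ K, ∀ e : X, x = μ • T x + e → ‖x‖ ≤ C * ‖e‖)
    (δ : ℝ) (hδ : 0 ≤ δ) (hδC : C * δ * L ≤ 1 / 2)
    (hres : AuxRes K T μ) : AuxRes K T (μ + δ) := by
  obtain ⟨R, hR, hRm⟩ := hres
  let x : X → ℕ → X := fun e n => Nat.rec 0 (fun _ y => R (e + δ • T y)) n
  have x0 : ∀ e, x e 0 = 0 := fun e => rfl
  have xs : ∀ e n, x e (n + 1) = R (e + δ • T (x e n)) := fun e n => rfl
  have hxK : ∀ e ∈ K, ∀ n, x e n ∈ K := by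
    intro e he n
    induction n with
    | zero => rw [x0]; exact hK0
    | succ n ih =>
      rw [xs]
      exact (hR _ (hKadd _ he _ (hKsmul _ hδ _ (hTK _ ih)))).1
  have harg : ∀ e ∈ K, ∀ n, e + δ • T (x e n) ∈ K := fun e he n =>
    hKadd _ he _ (hKsmul _ hδ _ (hTK _ (hxK e he n)))
  have hxinc : ∀ e ∈ K, ∀ n, x e (n + 1) - x e n ∈ K := by
    intro e he n
    induction n with
    | zero => rw [x0, sub_zero]; exact hxK e he 1
    | succ n ih =>
      rw [xs e (n + 1), xs e n]
      refine hRm _ (harg e he n) _ (harg e he (n + 1)) ?_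
      rw [add_sub_add_left_eq_sub, ← smul_sub]
      exact hKsmul _ hδ _ (hTmono _ _ ih)
  have hxmono : ∀ e ∈ K, ∀ e' ∈ K, e' - e ∈ K → ∀ n, x e' n - x e n ∈ K := by
    intro e he e' he' hee n
    induction n with
    | zero => rw [x0, x0, sub_zero]; exact hK0
    | succ n ih =>
      rw [xs, xs]
      refine hRm _ (harg e he n) _ (harg e' he' n) ?_
      rw [add_sub_add_comm, ← smul_sub]
      exact hKadd _ hee _ (hKsmul _ hδ _ (hTmono _ _ ih))
  have hxeq : ∀ e ∈ K, ∀ n, x e (n + 1) = μ • T (x e (n + 1)) + (e + δ • T (x e n)) := by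
    intro e he n
    have := (hR _ (harg e he n)).2
    rwa [← xs] at this
  have hbd : ∀ e ∈ K, ∀ n, ‖x e n‖ ≤ 2 * C * ‖e‖ := by
    intro e he n
    induction n with
    | zero => rw [x0, norm_zero]; positivity
    | succ n ih =>
      have h1 := hap _ (hxK e he (n + 1)) _ (hxeq e he n)
      have h2 : ‖e + δ • T (x e n)‖ ≤ ‖e‖ + δ * (L * ‖x e n‖) := by
        refine (norm_add_le _ _).trans ?_
        rw [norm_smul, Real.norm_of_nonneg hδ]
        gcongr
        exact hTL _
      have h3 : ‖x e (n + 1)‖ ≤ C * (‖e‖ + δ * (L * ‖x e n‖)) :=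
        h1.trans (mul_le_mul_of_nonneg_left h2 hC.le)
      have h4 : (C * δ * L) * ‖x e n‖ ≤ 1 / 2 * ‖x e n‖ :=
        mul_le_mul_of_nonneg_right hδC (norm_nonneg _)
      nlinarith
  have hlim : ∀ e ∈ K, ∃ l, Tendsto (x e) atTop (𝓝 l) := by
    intro e he
    obtain ⟨t, ht⟩ := aux_mono_conv K hKcl hK0 hKadd hKpointed _
      (hTcompact (Metric.closedBall 0 (2 * C * ‖e‖)) Metric.isBounded_closedBall)
      (fun n => T (x e n))
      (fun n => subset_closure ⟨x e n, by simpa using hbd e he n, rfl⟩)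
      (fun n => hTmono _ _ (hxinc e he n))
    refine ⟨μ • t + (e + δ • t), ?_⟩
    rw [← tendsto_add_atTop_iff_nat 1]
    have ht1 := (tendsto_add_atTop_iff_nat 1).2 ht
    refine ((ht1.const_smul μ).add ((ht.const_smul δ).const_add e)).congr fun n => ?_
    exact (hxeq e he n).symm
  choose! Q hQ using hlim
  refine ⟨Q, fun e he => ⟨?_, ?_⟩, fun e he e' he' hee => ?_⟩
  · exact hKcl.mem_of_tendsto (hQ e he) (Eventually.of_forall (hxK e he))
  · have ht := (hTcont.tendsto _).comp (hQ e he)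
    have ht1 := (tendsto_add_atTop_iff_nat 1).2 ht
    have h1 := (tendsto_add_atTop_iff_nat 1).2 (hQ e he)
    have h2 : Tendsto (fun n => x e (n + 1)) atTop (𝓝 (μ • T (Q e) + (e + δ • T (Q e)))) := by
      refine ((ht1.const_smul μ).add ((ht.const_smul δ).const_add e)).congr fun n => ?_
      exact (hxeq e he n).symm
    refine (tendsto_nhds_unique h1 h2).trans ?_
    rw [add_smul]
    abel
  · exact hKcl.mem_of_tendsto ((hQ e' he').sub (hQ e he))
      (Eventually.of_forall (hxmono e he e' he' hee))

theorem aux_final (K : Set X) (hKcl : IsClosed K)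
    (hKsmul : ∀ t : ℝ, 0 ≤ t → ∀ x ∈ K, t • x ∈ K)
    (hKadd : ∀ x ∈ K, ∀ y ∈ K, x + y ∈ K) (hK0 : (0 : X) ∈ K)
    (T : X → X)
    (hTmono : ∀ x y : X, y - x ∈ K → T y - T x ∈ K)
    (hThom : ∀ t : ℝ, 0 ≤ t → ∀ x : X, T (t • x) = t • T x)
    (u x : X) (hxu : x - u ∈ K) (M : ℝ) (hM : 0 < M) (p : ℕ)
    (hMu : M • (T^[p] u) - u ∈ K) (μ : ℝ) (hμ : 0 < μ) (hμM : M < μ ^ p)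
    (hx : x - μ • T x ∈ K) : -u ∈ K := by
  have itm : ∀ k, ∀ x y : X, y - x ∈ K → T^[k] y - T^[k] x ∈ K := by
    intro k
    induction k with
    | zero => intro x y h; exact h
    | succ k ih => intro x y h; exact ih _ _ (hTmono _ _ h)
  have ith : ∀ k, ∀ t : ℝ, 0 ≤ t → ∀ x : X, T^[k] (t • x) = t • T^[k] x := by
    intro k t ht
    induction k with
    | zero => intro x; rfl
    | succ k ih => intro x; simp only [Function.iterate_succ, Function.comp, hThom t ht, ih]
  have hxk : ∀ k, x - μ ^ k • T^[k] x ∈ K := by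
    intro k
    induction k with
    | zero => simpa using hK0
    | succ k ih =>
      have h1 := itm k _ _ hx
      rw [ith k μ hμ.le] at h1
      have h2 := hKadd _ ih _ (hKsmul (μ ^ k) (by positivity) _ h1)
      rw [smul_sub, smul_smul, ← pow_succ, sub_add_sub_cancel] at h2
      exact h2
  have hq : 0 < μ ^ p / M := by positivity
  have hs : ∀ n : ℕ, x - (μ ^ p / M) ^ n • u ∈ K := by
    intro n
    induction n with
    | zero => simpa using hxu
    | succ n ih =>
      set s := (μ ^ p / M) ^ n with hsdef
      have hs0 : 0 < s := by positivity
      have h1 := itm p _ _ ih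
      rw [ith p s hs0.le] at h1
      have h2 := hKsmul (μ ^ p) (by positivity) _ h1
      have h3 := hKsmul (μ ^ p * s / M) (by positivity) _ hMu
      have h4 := hKadd _ (hKadd _ (hxk p) _ h2) _ h3
      have e1 : μ ^ p * s / M * M = μ ^ p * s := by field_simp
      have e2 : (μ ^ p / M) ^ (n + 1) = μ ^ p * s / M := by rw [pow_succ, ← hsdef]; ring
      rw [smul_sub, smul_sub, smul_smul, smul_smul, e1, sub_add_sub_cancel,
        sub_add_sub_cancel] at h4
      rw [e2]
      exact h4
  set r := (μ ^ p / M)⁻¹ with hr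
  have hr0 : 0 < r := by positivity
  have hr1 : r < 1 := inv_lt_one_of_one_lt₀ (by rwa [one_lt_div hM])
  have ht : Tendsto (fun n : ℕ => r ^ n • x - u) atTop (𝓝 ((0 : ℝ) • x - u)) :=
    ((tendsto_pow_atTop_nhds_zero_of_lt_one hr0.le hr1).smul_const x).sub_const u
  rw [zero_smul, zero_sub] at ht
  refine hKcl.mem_of_tendsto ht (Eventually.of_forall fun n => ?_)
  have h5 := hKsmul (r ^ n) (by positivity) _ (hs n)
  rw [smul_sub, smul_smul, ← mul_pow, hr, inv_mul_cancel₀ hq.ne', one_pow, one_smul] at h5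
  exact h5

end aux

/-- Existence part of the nonlinear Kreĭn–Rutman theorem under assumption (A1):
if `T` is order-preserving, 1-homogeneous and completely continuous, and
`M T^p(u) ≽ u` for some `u = v - w` with `v, w ∈ K`, `u ≠ 0`, `-u ∉ K`, then
`T` has a unit eigenvector `x₀ ∈ K` with eigenvalue `λ₀ ≥ M^{-1/p}`. -/
theorem stmt_8 {X : Type*} [NormedAddCommGroup X] [NormedSpace ℝ X] [CompleteSpace X]
    (K : Set X) (hKne : K.Nonempty) (hKcl : IsClosed K)
    (hKsmul : ∀ t : ℝ, 0 ≤ t → ∀ x ∈ K, t • x ∈ K)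
    (hKadd : ∀ x ∈ K, ∀ y ∈ K, x + y ∈ K)
    (hKpointed : ∀ x ∈ K, -x ∈ K → x = 0)
    (T : X → X)
    (hTmono : ∀ x y : X, y - x ∈ K → T y - T x ∈ K)
    (hThom : ∀ t : ℝ, 0 ≤ t → ∀ x : X, T (t • x) = t • T x)
    (hTcont : Continuous T)
    (hTcompact : ∀ s : Set X, IsBounded s → IsCompact (closure (T '' s)))
    (v w : X) (hv : v ∈ K) (hw : w ∈ K) (u : X) (hu : u = v - w)
    (hu0 : u ≠ 0) (hnu : -u ∉ K)
    (M : ℝ) (hM : 0 < M) (p : ℕ) (hp : 0 < p)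
    (hMu : M • (T^[p] u) - u ∈ K) :
    ∃ x₀ ∈ K, ‖x₀‖ = 1 ∧ ∃ l : ℝ, M ^ (-(1 : ℝ) / p) ≤ l ∧ T x₀ = l • x₀ := by
  have hK0 : (0 : X) ∈ K := by
    obtain ⟨k, hk⟩ := hKne
    simpa using hKsmul 0 le_rfl k hk
  have hT0 : T 0 = 0 := by simpa using hThom 0 le_rfl 0
  have hTK : ∀ x ∈ K, T x ∈ K := by
    intro x hx
    simpa [hT0] using hTmono 0 x (by simpa using hx)
  set B : ℝ := M ^ ((1 : ℝ) / p) with hB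
  have hBpos : 0 < B := Real.rpow_pos_of_pos hM _
  have hBp : B ^ p = M := by
    rw [hB, one_div]
    exact Real.rpow_inv_natCast_pow hM.le hp.ne'
  have hBinv : M ^ (-(1 : ℝ) / p) = B⁻¹ := by
    rw [hB, neg_div, Real.rpow_neg hM.le]
  by_contra hcon
  have hno : ∀ μ : ℝ, 0 ≤ μ → μ ≤ B → ∀ x ∈ K, ‖x‖ = 1 → x ≠ μ • T x := by
    intro μ h0 hμB x hx hx1 heq
    have hμ : 0 < μ := by
      rcases h0.eq_or_lt with h | h
      · exfalso
        rw [← h, zero_smul] at heq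
        rw [heq, norm_zero] at hx1
        exact zero_ne_one hx1
      · exact h
    refine hcon ⟨x, hx, hx1, μ⁻¹, ?_, ?_⟩
    · rw [hBinv]
      exact inv_anti₀ hμ hμB
    · conv_rhs => rw [heq]
      rw [smul_smul, inv_mul_cancel₀ hμ.ne', one_smul]
  obtain ⟨C, hC, hap⟩ := aux_apriori K hKcl hKsmul T hThom hTcont hTcompact B hno
  obtain ⟨L, hL, hTL⟩ : ∃ L : ℝ, 0 < L ∧ ∀ x, ‖T x‖ ≤ L * ‖x‖ := by
    obtain ⟨L, hL, hb⟩ := (hTcompact (Metric.closedBall 0 1)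
      Metric.isBounded_closedBall).isBounded.exists_pos_norm_le
    refine ⟨L, hL, fun x => ?_⟩
    rcases eq_or_ne x 0 with rfl | hx
    · simp [hT0]
    have hxp : 0 < ‖x‖ := norm_pos_iff.2 hx
    have h1 := hb (T (‖x‖⁻¹ • x)) (subset_closure ⟨_, by
      simp [norm_smul, inv_mul_cancel₀ hxp.ne'], rfl⟩)
    rw [hThom _ (by positivity), norm_smul, norm_inv, norm_norm, inv_mul_le_iff₀ hxp] at h1
    linarith
  set δ : ℝ := 1 / (2 * C * L) with hδ
  have hδpos : 0 < δ := by positivity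
  have hδC : C * δ * L ≤ 1 / 2 := by
    rw [hδ]
    apply le_of_eq
    field_simp
  have hind : ∀ n : ℕ, (n : ℝ) * δ ≤ B + δ → AuxRes K T ((n : ℝ) * δ) := by
    intro n
    induction n with
    | zero =>
      intro _
      exact ⟨id, fun e he => ⟨he, by simp⟩, fun e _ e' _ h => h⟩
    | succ n ih =>
      intro h
      push_cast at h ⊢
      have h1 : (n : ℝ) * δ ≤ B := by linarith
      rw [add_mul, one_mul]
      exact aux_step K hKcl hK0 hKsmul hKadd hKpointed T hTK hTmono hTcont hTcompact L hTL C hC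
        _ (hap _ (by positivity) h1) δ hδpos.le hδC (ih (by linarith))
  have hfl := Nat.floor_le (show 0 ≤ B / δ by positivity)
  have hlt := Nat.lt_floor_add_one (B / δ)
  rw [le_div_iff₀ hδpos] at hfl
  rw [div_lt_iff₀ hδpos] at hlt
  obtain ⟨R, hR, -⟩ := hind (⌊B / δ⌋₊ + 1) (by push_cast; linarith)
  push_cast at hR
  set μ : ℝ := ((⌊B / δ⌋₊ : ℝ) + 1) * δ with hμ
  have hμpos : 0 < μ := hBpos.trans hlt
  obtain ⟨hRK, hReq⟩ := hR v hv
  refine hnu (aux_final K hKcl hKsmul hKadd hK0 T hTmono hThom u (R v) ?_ M hM p hMu μ hμpos ?_ ?_)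
  · have h1 : R v - u = μ • T (R v) + w := by
      conv_lhs => rw [hReq]
      rw [hu]
      abel
    rw [h1]
    exact hKadd _ (hKsmul _ hμpos.le _ (hTK _ hRK)) _ hw
  · rw [← hBp]
    exact pow_lt_pow_left₀ hlt hBpos.le hp.ne'
  · have h1 : R v - μ • T (R v) = v := sub_eq_iff_eq_add'.2 hReq
    rw [h1]
    exact hv
end

section
/- Suppose the interior of K is nonempty and T : X → X is order-preserving, 1-homogeneous, and satisfies condition (B1). If x, y ∈ K with x ≠ 0 and y ≠ 0 satisfy T(x) = λ·x and T(y) = μ·y with λ > 0 and μ > 0, then λ = μ; that is, the set σ₊(T) of positive eigenvalues of T admitting an eigenvector in K \ {0} has at most one element. -/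
/-- If the cone `K` has nonempty interior and `T` is order-preserving,
1-homogeneous and satisfies (B1), then the positive eigenvalue of `T` with an
eigenvector in `K \ {0}` is unique: the set `σ₊(T)` has at most one element. -/
theorem stmt_12 {X : Type*} [NormedAddCommGroup X] [NormedSpace ℝ X] [CompleteSpace X]
    (K : Set X) (hKne : K.Nonempty) (hKcl : IsClosed K)
    (hKsmul : ∀ t : ℝ, 0 ≤ t → ∀ x ∈ K, t • x ∈ K)
    (hKadd : ∀ x ∈ K, ∀ y ∈ K, x + y ∈ K)
    (hKpointed : ∀ x ∈ K, -x ∈ K → x = 0)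
    (hKint : (interior K).Nonempty)
    (T : X → X)
    (hTmono : ∀ x y : X, y - x ∈ K → T y - T x ∈ K)
    (hThom : ∀ t : ℝ, 0 ≤ t → ∀ x : X, T (t • x) = t • T x)
    (hB1 : ∀ x ∈ frontier K, x ≠ 0 → ∀ β : ℝ, 0 < β → x - β • T x ∉ K) :
    (∀ x ∈ K, x ≠ 0 → ∀ y ∈ K, y ≠ 0 → ∀ lam mu : ℝ, 0 < lam → 0 < mu →
        T x = lam • x → T y = mu • y → lam = mu) ∧
      {l : ℝ | 0 < l ∧ ∃ x ∈ K, x ≠ 0 ∧ T x = l • x}.Subsingleton := by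
  have h0 : (0 : X) ∈ K := by
    obtain ⟨k, hk⟩ := hKne
    simpa using hKsmul 0 le_rfl k hk
  have hint : ∀ x ∈ K, x ≠ 0 → ∀ lam : ℝ, 0 < lam → T x = lam • x → x ∈ interior K := by
    intro x hx hx0 lam hl hT
    by_contra hni
    have hf : x ∈ frontier K := ⟨subset_closure hx, hni⟩
    apply hB1 x hf hx0 lam⁻¹ (inv_pos.mpr hl)
    rw [hT, smul_smul, inv_mul_cancel₀ hl.ne', one_smul, sub_self]
    exact h0
  have key : ∀ x ∈ K, x ≠ 0 → ∀ y ∈ K, y ≠ 0 → ∀ lam mu : ℝ, 0 < lam → 0 < mu →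
        T x = lam • x → T y = mu • y → mu ≤ lam := by
    intro x hx hx0 y hy hy0 lam mu hl hm hTx hTy
    by_contra hlt
    push Not at hlt
    have hxi := hint x hx hx0 lam hl hTx
    have hcont : Filter.Tendsto (fun e : ℝ => x - e • y) (nhdsWithin 0 (Set.Ioi 0)) (nhds x) := by
      have h : Continuous (fun e : ℝ => x - e • y) := by fun_prop
      have h2 := h.tendsto 0
      simp only [zero_smul, sub_zero] at h2
      exact h2.mono_left nhdsWithin_le_nhds
    have hev := hcont.eventually (mem_interior_iff_mem_nhds.mp hxi)
    obtain ⟨e, heK, he⟩ := (hev.and self_mem_nhdsWithin).exists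
    have he : 0 < e := he
    have hn : ∀ n : ℕ, (e⁻¹ * (lam / mu) ^ n) • x - y ∈ K := by
      intro n
      induction n with
      | zero =>
        have h := hKsmul e⁻¹ (inv_pos.mpr he).le _ heK
        rw [smul_sub, smul_smul, inv_mul_cancel₀ he.ne', one_smul] at h
        simpa using h
      | succ n ih =>
        have h := hTmono _ _ ih
        rw [hThom _ (by positivity), hTx, hTy] at h
        have h2 := hKsmul mu⁻¹ (inv_pos.mpr hm).le _ h
        rw [smul_sub, smul_smul mu⁻¹ mu, inv_mul_cancel₀ hm.ne', one_smul, smul_smul,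
          smul_smul] at h2
        convert h2 using 3
        rw [pow_succ]
        field_simp
    have hlim : Filter.Tendsto (fun n : ℕ => (e⁻¹ * (lam / mu) ^ n) • x - y) Filter.atTop
        (nhds (-y)) := by
      have h1 := tendsto_pow_atTop_nhds_zero_of_lt_one (r := lam / mu) (by positivity)
        ((div_lt_one hm).mpr hlt)
      have h2 := ((h1.const_mul e⁻¹).smul_const x).sub_const y
      simpa using h2
    exact hy0 (hKpointed y hy (hKcl.mem_of_tendsto hlim (Filter.Eventually.of_forall hn)))
  have main : ∀ x ∈ K, x ≠ 0 → ∀ y ∈ K, y ≠ 0 → ∀ lam mu : ℝ, 0 < lam → 0 < mu →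
        T x = lam • x → T y = mu • y → lam = mu := by
    intro x hx hx0 y hy hy0 lam mu hl hm hTx hTy
    exact le_antisymm (key y hy hy0 x hx hx0 mu lam hm hl hTy hTx)
      (key x hx hx0 y hy hy0 lam mu hl hm hTx hTy)
  refine ⟨main, ?_⟩
  rintro l ⟨hl, x, hx, hx0, hTx⟩ m ⟨hm, y, hy, hy0, hTy⟩
  exact main x hx hx0 y hy hy0 l m hl hm hTx hTy
end

section
/- Suppose the interior of K is nonempty and T : X → X is order-preserving, 1-homogeneous, and satisfies condition (B2). If x and y both lie in the interior of K, ‖x‖ = ‖y‖ = 1, and T(x) = λ·x, T(y) = μ·y with λ > 0 and μ > 0, then x = y (the unit eigenvector in the interior of K is unique). -/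
open Filter Topology in
theorem stmt_14_aux {X : Type*} [NormedAddCommGroup X] [NormedSpace ℝ X]
    (K : Set X) (hKcl : IsClosed K)
    (hKsmul : ∀ t : ℝ, 0 ≤ t → ∀ x ∈ K, t • x ∈ K)
    (hKpointed : ∀ x ∈ K, -x ∈ K → x = 0)
    (T : X → X)
    (hThom : ∀ t : ℝ, 0 ≤ t → ∀ x : X, T (t • x) = t • T x)
    (hB2 : ∀ x y : X, x - y ∈ frontier K → x - y ≠ 0 →
      ∀ β : ℝ, 0 < β → x - y - β • (T x - T y) ∉ K)
    (x y : X) (hx : x ∈ K) (hy : y ∈ K)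
    (hxn : ‖x‖ = 1) (hyn : ‖y‖ = 1)
    (lam mu : ℝ) (hlam : 0 < lam) (hle : lam ≤ mu)
    (hTx : T x = lam • x) (hTy : T y = mu • y) :
    x = y := by
  have hcont : Continuous (fun t : ℝ => x - t • y) := by fun_prop
  set S : Set ℝ := {t | x - t • y ∈ K} with hS
  have hScl : IsClosed S := hKcl.preimage hcont
  have h0 : (0 : ℝ) ∈ S := by simpa [hS] using hx
  have hbdd : BddAbove S := by
    by_contra hb
    rw [not_bddAbove_iff] at hb
    have hfr : ∃ᶠ t : ℝ in atTop, t⁻¹ • x - y ∈ K := by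
      rw [frequently_atTop']
      intro a
      obtain ⟨t, ht, hat⟩ := hb (max a 0)
      have ht0 : 0 < t := lt_of_le_of_lt (le_max_right _ _) hat
      refine ⟨t, lt_of_le_of_lt (le_max_left _ _) hat, ?_⟩
      have := hKsmul t⁻¹ (by positivity) _ ht
      rwa [smul_sub, smul_smul, inv_mul_cancel₀ ht0.ne', one_smul] at this
    have hlim : Tendsto (fun t : ℝ => t⁻¹ • x - y) atTop (𝓝 (-y)) := by
      have h := ((tendsto_inv_atTop_zero (𝕜 := ℝ)).smul_const x).sub_const y
      simpa using h
    have := hKpointed y hy (hKcl.mem_of_frequently_of_tendsto hfr hlim)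
    simp [this] at hyn
  set t := sSup S with ht
  have htS : t ∈ S := hScl.csSup_mem ⟨0, h0⟩ hbdd
  have ht0 : 0 ≤ t := le_csSup hbdd h0
  have hfront : x - t • y ∈ frontier K := by
    rw [hKcl.frontier_eq]
    refine ⟨htS, fun hint => ?_⟩
    have hev : ∀ᶠ s in 𝓝 t, x - s • y ∈ interior K :=
      hcont.continuousAt.eventually (isOpen_interior.mem_nhds hint)
    obtain ⟨s, hs, hts⟩ :=
      ((hev.filter_mono (nhdsWithin_le_nhds (s := Set.Ioi t))).and self_mem_nhdsWithin).exists
    have hsK : x - s • y ∈ K := interior_subset hs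
    exact absurd (le_csSup hbdd (show s ∈ S from hsK)) (not_le.mpr hts)
  by_cases hz : x - t • y = 0
  · have hxy : x = t • y := sub_eq_zero.mp hz
    have : t = 1 := by
      have h := hxn
      rw [hxy, norm_smul, hyn, mul_one, Real.norm_of_nonneg ht0] at h
      exact h
    rw [hxy, this, one_smul]
  · exfalso
    apply hB2 x (t • y) hfront hz lam⁻¹ (by positivity)
    have e : x - t • y - lam⁻¹ • (T x - T (t • y)) = ((lam⁻¹ * mu - 1) * t) • y := by
      rw [hThom t ht0, hTx, hTy, smul_sub, smul_smul, inv_mul_cancel₀ hlam.ne']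
      module
    rw [e]
    refine hKsmul _ (mul_nonneg ?_ ht0) _ hy
    have : lam⁻¹ * lam ≤ lam⁻¹ * mu := by gcongr
    rw [inv_mul_cancel₀ hlam.ne'] at this
    linarith

/-- If the cone `K` has nonempty interior and `T` is order-preserving,
1-homogeneous and satisfies (B2), then the unit eigenvector of `T` in the
interior of `K` (with a positive eigenvalue) is unique. -/
theorem stmt_14 {X : Type*} [NormedAddCommGroup X] [NormedSpace ℝ X] [CompleteSpace X]
    (K : Set X) (hKne : K.Nonempty) (hKcl : IsClosed K)
    (hKsmul : ∀ t : ℝ, 0 ≤ t → ∀ x ∈ K, t • x ∈ K)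
    (hKadd : ∀ x ∈ K, ∀ y ∈ K, x + y ∈ K)
    (hKpointed : ∀ x ∈ K, -x ∈ K → x = 0)
    (hKint : (interior K).Nonempty)
    (T : X → X)
    (hTmono : ∀ x y : X, y - x ∈ K → T y - T x ∈ K)
    (hThom : ∀ t : ℝ, 0 ≤ t → ∀ x : X, T (t • x) = t • T x)
    (hB2 : ∀ x y : X, x - y ∈ frontier K → x - y ≠ 0 →
      ∀ β : ℝ, 0 < β → x - y - β • (T x - T y) ∉ K)
    (x y : X) (hx : x ∈ interior K) (hy : y ∈ interior K)
    (hxn : ‖x‖ = 1) (hyn : ‖y‖ = 1)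
    (lam mu : ℝ) (hlam : 0 < lam) (hmu : 0 < mu)
    (hTx : T x = lam • x) (hTy : T y = mu • y) :
    x = y := by
  have hxK := interior_subset hx
  have hyK := interior_subset hy
  rcases le_total lam mu with h | h
  · exact stmt_14_aux K hKcl hKsmul hKpointed T hThom hB2 x y hxK hyK hxn hyn lam mu hlam h hTx hTy
  · exact (stmt_14_aux K hKcl hKsmul hKpointed T hThom hB2 y x hyK hxK hyn hxn mu lam hmu h
      hTy hTx).symm
end

section
/- Suppose the interior of K is nonempty and T : X → X maps K into K, is 1-homogeneous, is superadditive on K (T(x) + T(y) ≼ T(x + y) for all x, y ∈ K), and satisfies condition (B1). If x, y ∈ K with ‖x‖ = ‖y‖ = 1 satisfy T(x) = λ·x and T(y) = μ·y with λ > 0 and μ > 0, then x = y (uniqueness of the unit eigenvector in K). -/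
theorem stmt_15_aux {X : Type*} [NormedAddCommGroup X] [NormedSpace ℝ X]
    (K : Set X) (hKcl : IsClosed K)
    (hKsmul : ∀ t : ℝ, 0 ≤ t → ∀ x ∈ K, t • x ∈ K)
    (hKadd : ∀ x ∈ K, ∀ y ∈ K, x + y ∈ K)
    (hKpointed : ∀ x ∈ K, -x ∈ K → x = 0)
    (T : X → X)
    (hThom : ∀ t : ℝ, 0 ≤ t → ∀ x : X, T (t • x) = t • T x)
    (hTsuper : ∀ x ∈ K, ∀ y ∈ K, T (x + y) - (T x + T y) ∈ K)
    (hB1 : ∀ x ∈ frontier K, x ≠ 0 → ∀ β : ℝ, 0 < β → x - β • T x ∉ K)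
    (x y : X) (hx : x ∈ K) (hy : y ∈ K)
    (hxn : ‖x‖ = 1) (hyn : ‖y‖ = 1)
    (lam mu : ℝ) (hlam : 0 < lam) (hle : lam ≤ mu)
    (hTx : T x = lam • x) (hTy : T y = mu • y) :
    x = y := by
  have hny : -y ∉ K := fun h => by
    have := hKpointed y hy h
    simp [this] at hyn
  let S : Set ℝ := {t | 0 ≤ t ∧ x - t • y ∈ K}
  have hScl : IsClosed S :=
    isClosed_Ici.inter (hKcl.preimage (by fun_prop : Continuous fun t : ℝ => x - t • y))
  have hSne : S.Nonempty := ⟨0, le_refl _, by simpa using hx⟩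
  have hSb : BddAbove S := by
    have ho : IsOpen {s : ℝ | s • x - y ∉ K} :=
      hKcl.isOpen_compl.preimage (by fun_prop : Continuous fun s : ℝ => s • x - y)
    obtain ⟨ε, hε, hb⟩ := Metric.isOpen_iff.1 ho 0 (by simpa using hny)
    refine ⟨1 / ε, fun t ht => ?_⟩
    by_contra! hlt
    have htp : 0 < t := lt_trans (by positivity) hlt
    refine hb (a := t⁻¹) ?_ ?_
    · simp only [Metric.mem_ball, dist_zero_right, norm_inv, Real.norm_eq_abs, abs_of_pos htp]
      rw [inv_lt_comm₀ htp hε]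
      simpa using hlt
    · have := hKsmul t⁻¹ (by positivity) _ ht.2
      rwa [smul_sub, smul_smul, inv_mul_cancel₀ htp.ne', one_smul] at this
  obtain ⟨ht0, hz⟩ : sSup S ∈ S := hScl.csSup_mem hSne hSb
  have hub : ∀ s ∈ S, s ≤ sSup S := fun s hs => le_csSup hSb hs
  generalize sSup S = t at ht0 hz hub
  have hfr : x - t • y ∈ frontier K := by
    refine ⟨subset_closure hz, fun hint => ?_⟩
    have ho : IsOpen {s : ℝ | x - s • y ∈ interior K} :=
      isOpen_interior.preimage (by fun_prop : Continuous fun s : ℝ => x - s • y)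
    obtain ⟨ε, hε, hb⟩ := Metric.isOpen_iff.1 ho t hint
    have h1 : x - (t + ε / 2) • y ∈ interior K := hb (a := t + ε / 2) (by
      simp only [Metric.mem_ball, dist_self_add_left, Real.norm_eq_abs]
      rw [abs_of_pos (by positivity)]
      linarith)
    have := hub (t + ε / 2) ⟨by positivity, interior_subset h1⟩
    linarith
  by_cases hz0 : x - t • y = 0
  · have hxy : x = t • y := sub_eq_zero.1 hz0
    have : t = 1 := by
      have h := congrArg norm hxy
      rw [norm_smul, hxn, hyn, Real.norm_eq_abs, abs_of_nonneg ht0] at h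
      linarith
    rw [hxy, this, one_smul]
  · exfalso
    refine hB1 _ hfr hz0 lam⁻¹ (by positivity) ?_
    have h1 := hTsuper _ hz _ (hKsmul t ht0 y hy)
    rw [sub_add_cancel, hThom t ht0, hTx, hTy] at h1
    have h2 := hKadd _ h1 _ (hKsmul (t * (mu - lam)) (mul_nonneg ht0 (by linarith)) y hy)
    have h3 := hKsmul lam⁻¹ (by positivity) _ h2
    have h4 : lam • x - (T (x - t • y) + t • mu • y) + (t * (mu - lam)) • y
        = lam • (x - t • y) - T (x - t • y) := by
      module
    rwa [h4, smul_sub, smul_smul, inv_mul_cancel₀ hlam.ne', one_smul] at h3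

/-- Uniqueness part of Theorem 3 for superadditive maps: if the cone `K` has
nonempty interior, `T` maps `K` into `K`, is 1-homogeneous, superadditive on `K`,
and satisfies (B1), then the unit eigenvector of `T` in `K` (with a positive
eigenvalue) is unique. -/
theorem stmt_15 {X : Type*} [NormedAddCommGroup X] [NormedSpace ℝ X] [CompleteSpace X]
    (K : Set X) (hKne : K.Nonempty) (hKcl : IsClosed K)
    (hKsmul : ∀ t : ℝ, 0 ≤ t → ∀ x ∈ K, t • x ∈ K)
    (hKadd : ∀ x ∈ K, ∀ y ∈ K, x + y ∈ K)
    (hKpointed : ∀ x ∈ K, -x ∈ K → x = 0)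
    (hKint : (interior K).Nonempty)
    (T : X → X) (hTK : ∀ x ∈ K, T x ∈ K)
    (hThom : ∀ t : ℝ, 0 ≤ t → ∀ x : X, T (t • x) = t • T x)
    (hTsuper : ∀ x ∈ K, ∀ y ∈ K, T (x + y) - (T x + T y) ∈ K)
    (hB1 : ∀ x ∈ frontier K, x ≠ 0 → ∀ β : ℝ, 0 < β → x - β • T x ∉ K)
    (x y : X) (hx : x ∈ K) (hy : y ∈ K)
    (hxn : ‖x‖ = 1) (hyn : ‖y‖ = 1)
    (lam mu : ℝ) (hlam : 0 < lam) (hmu : 0 < mu)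
    (hTx : T x = lam • x) (hTy : T y = mu • y) :
    x = y := by
  rcases le_total lam mu with h | h
  · exact stmt_15_aux K hKcl hKsmul hKadd hKpointed T hThom hTsuper hB1 x y hx hy hxn hyn
      lam mu hlam h hTx hTy
  · exact (stmt_15_aux K hKcl hKsmul hKadd hKpointed T hThom hTsuper hB1 y x hy hx hyn hxn
      mu lam hmu h hTy hTx).symm
end

section
/- Suppose T : X → X is superadditive on X (T(x) + T(y) ≼ T(x + y) for all x, y ∈ X) and satisfies condition (B1). Then T satisfies condition (B2). -/
/-- If `T` is superadditive on `X` and satisfies condition (B1), then `T`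
satisfies condition (B2). -/
theorem stmt_16 {X : Type*} [NormedAddCommGroup X] [NormedSpace ℝ X] [CompleteSpace X]
    (K : Set X) (hKne : K.Nonempty) (hKcl : IsClosed K)
    (hKsmul : ∀ t : ℝ, 0 ≤ t → ∀ x ∈ K, t • x ∈ K)
    (hKadd : ∀ x ∈ K, ∀ y ∈ K, x + y ∈ K)
    (hKpointed : ∀ x ∈ K, -x ∈ K → x = 0)
    (T : X → X)
    (hTsuper : ∀ x y : X, T (x + y) - (T x + T y) ∈ K)
    (hB1 : ∀ x ∈ frontier K, x ≠ 0 → ∀ β : ℝ, 0 < β → x - β • T x ∉ K) :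
    ∀ x y : X, x - y ∈ frontier K → x - y ≠ 0 →
      ∀ β : ℝ, 0 < β → x - y - β • (T x - T y) ∉ K := by
  intro x y hf hne β hβ hmem
  refine hB1 (x - y) hf hne β hβ ?_
  have h1 := hTsuper (x - y) y
  rw [sub_add_cancel] at h1
  have h2 := hKadd _ hmem _ (hKsmul β hβ.le _ h1)
  have h3 : x - y - β • (T x - T y) + β • (T x - (T (x - y) + T y)) = x - y - β • T (x - y) := by
    module
  rwa [h3] at h2
end
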